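/- Let X be a complete CAT(0) space and g an isometry of X translating a geodesic line r nontrivially, with endpoints ξ⁻ = r(−∞) and ξ⁺ = r(+∞) in the boundary at infinity. If g fixes a point ξ ∈ ∂∞X, then ∠_Tits(ξ⁻, ξ) + ∠_Tits(ξ, ξ⁺) = π. In particular, if ξ is opposite to ξ⁻ (i.e. ∠_Tits(ξ⁻, ξ) = π and they are joined by a geodesic), then ξ = ξ⁺. -/

import Mathlib

open Filter
open scoped NNReal

/-- A geodesic metric space (existence of midpoints) satisfying the CN inequality
of Bruhat–Tits, an equivalent characterization of CAT(0). -/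
structure IsCAT0 (X : Type*) [MetricSpace X] : Prop where
  midpoint : ∀ x y : X, ∃ m : X, dist x m = dist x y / 2 ∧ dist m y = dist x y / 2
  cn : ∀ x y z m : X, dist y m = dist y z / 2 → dist m z = dist y z / 2 →
    dist x m ^ 2 ≤ dist x y ^ 2 / 2 + dist x z ^ 2 / 2 - dist y z ^ 2 / 4

/-- Two geodesic rays are asymptotic if they stay at bounded distance. -/
def AsympRay {X : Type*} [MetricSpace X] (c c' : ℝ≥0 → X) : Prop :=
  ∃ C : ℝ, ∀ t, dist (c t) (c' t) ≤ C

/-- The Tits angle between the boundary points determined by two unit-speed rays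
`c`, `c'`, via the CAT(0) formula `2 sin(∠_Tits/2) = lim_t d(c(t), c'(t))/t`. -/
noncomputable def titsAngle {X : Type*} [MetricSpace X] (c c' : ℝ≥0 → X) : ℝ :=
  2 * Real.arcsin ((Filter.limsup (fun t : ℝ≥0 => dist (c t) (c' t) / (t : ℝ)) Filter.atTop) / 2)

open Topology

theorem aux_sq {u v K : ℝ} (hv : 0 < v) (hK : 0 ≤ K) (h : u ^ 2 ≤ v ^ 2 + K) :
    u ≤ v + K / (2 * v) := by
  have h1 : 0 ≤ K / (2 * v) := by positivity
  refine le_of_abs_le (abs_le_of_sq_le_sq ?_ (by linarith))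
  have : v * (K / (2 * v)) = K / 2 := by field_simp
  nlinarith [sq_nonneg (K / (2 * v))]

theorem dist_ray {X : Type*} [MetricSpace X] {c : ℝ≥0 → X} (hc : Isometry c) (s t : ℝ≥0) :
    dist (c s) (c t) = |(s : ℝ) - t| := by
  rw [hc.dist_eq, NNReal.dist_eq]

theorem nn_tendsto : Tendsto (fun s : ℝ≥0 => (s : ℝ)) atTop atTop :=
  NNReal.tendsto_coe_atTop.2 tendsto_id

theorem busemann_exists {X : Type*} [MetricSpace X] {c : ℝ≥0 → X} (hc : Isometry c) (x : X) :
    ∃ b : ℝ, Tendsto (fun s : ℝ≥0 => dist x (c s) - (s : ℝ)) atTop (𝓝 b) := by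
  refine ⟨_, tendsto_atTop_ciInf ?_ ?_⟩
  · intro s t hst
    have h := dist_triangle x (c s) (c t)
    have hst' : (s : ℝ) ≤ t := by exact_mod_cast hst
    rw [dist_ray hc, abs_sub_comm, abs_of_nonneg (by linarith)] at h
    simp only
    linarith
  · refine ⟨-dist x (c 0), ?_⟩
    rintro _ ⟨s, rfl⟩
    have h := dist_triangle (c 0) x (c s)
    rw [dist_ray hc, abs_sub_comm, NNReal.coe_zero, sub_zero, NNReal.abs_eq,
      dist_comm (c 0) x] at h
    simp only
    linarith

theorem busemann_cmp {X : Type*} [MetricSpace X] (hX : IsCAT0 X) {c c' : ℝ≥0 → X} {C : ℝ}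
    (hC : ∀ s, dist (c s) (c' s) ≤ C) {x y : X} {bx by_ bx' by' : ℝ}
    (h1 : Tendsto (fun s : ℝ≥0 => dist x (c s) - (s : ℝ)) atTop (𝓝 bx))
    (h2 : Tendsto (fun s : ℝ≥0 => dist y (c s) - (s : ℝ)) atTop (𝓝 by_))
    (h3 : Tendsto (fun s : ℝ≥0 => dist x (c' s) - (s : ℝ)) atTop (𝓝 bx'))
    (h4 : Tendsto (fun s : ℝ≥0 => dist y (c' s) - (s : ℝ)) atTop (𝓝 by')) :
    by' - bx' ≤ by_ - bx := by
  have hv : Tendsto (fun s : ℝ≥0 => dist y (c s) - dist x (c s) / 2) atTop atTop := by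
    have := (h2.sub (h1.div_const 2)).add_atTop (nn_tendsto.atTop_div_const (r := 2) (by norm_num))
    refine this.congr fun s => by ring
  have hw : Tendsto (fun s : ℝ≥0 => dist x (c' s) - dist x (c s) / 2) atTop atTop := by
    have := (h3.sub (h1.div_const 2)).add_atTop (nn_tendsto.atTop_div_const (r := 2) (by norm_num))
    refine this.congr fun s => by ring
  have e1 : Tendsto (fun s : ℝ≥0 => (dist x y ^ 2 / 2) /
      (2 * (dist y (c s) - dist x (c s) / 2))) atTop (𝓝 0) :=
    (hv.const_mul_atTop (by norm_num)).const_div_atTop _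
  have e2 : Tendsto (fun s : ℝ≥0 => (C ^ 2 / 2) /
      (2 * (dist x (c' s) - dist x (c s) / 2))) atTop (𝓝 0) :=
    (hw.const_mul_atTop (by norm_num)).const_div_atTop _
  have hR := ((h2.sub h1).add e1).add e2
  rw [add_zero, add_zero] at hR
  refine le_of_tendsto_of_tendsto (h4.sub h3) hR ?_
  filter_upwards [hv.eventually_gt_atTop 0, hw.eventually_gt_atTop 0] with s hs1 hs2
  obtain ⟨p, hp1, hp2⟩ := hX.midpoint x (c s)
  have n1 := hX.cn y x (c s) p hp1 hp2
  have n2 := hX.cn (c' s) x (c s) p hp1 hp2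
  have hD : dist (c' s) (c s) ^ 2 ≤ C ^ 2 := by
    rw [dist_comm]; exact pow_le_pow_left₀ dist_nonneg (hC s) 2
  rw [dist_comm y x] at n1
  rw [dist_comm (c' s) x] at n2
  have a1 := aux_sq (u := dist y p) (K := dist x y ^ 2 / 2) hs1 (by positivity)
    (by nlinarith [sq_nonneg (dist y (c s) - dist x (c s))])
  have a2 := aux_sq (u := dist (c' s) p) (K := C ^ 2 / 2) hs2 (by positivity)
    (by nlinarith [sq_nonneg (dist x (c' s) - dist x (c s))])
  have t := dist_triangle y p (c' s)
  rw [dist_comm p] at t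
  linarith

theorem double_bound {G : ℝ≥0 → ℝ} {L : ℝ} (h : ∀ s, G s ≤ G (2 * s) / 2)
    (hL : Tendsto (fun s : ℝ≥0 => G s / (s : ℝ)) atTop (𝓝 L)) (s : ℝ≥0) (hs : 0 < s) :
    G s ≤ s * L := by
  have hn : ∀ n : ℕ, G s ≤ G (2 ^ n * s) / 2 ^ n := by
    intro n
    induction n with
    | zero => simp
    | succ k ih =>
      have := h (2 ^ k * s)
      refine ih.trans ?_
      rw [pow_succ', pow_succ' (2 : ℝ), mul_assoc, ← div_div]
      gcongr
  have hs' : (0 : ℝ) < s := by exact_mod_cast hs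
  have ht : Tendsto (fun n : ℕ => 2 ^ n * s) atTop atTop :=
    (tendsto_pow_atTop_atTop_of_one_lt (by norm_num : (1 : ℝ≥0) < 2)).atTop_mul_const hs
  refine ge_of_tendsto' ((hL.comp ht).const_mul (s : ℝ)) fun n => (hn n).trans (le_of_eq ?_)
  simp only [Function.comp, NNReal.coe_mul, NNReal.coe_pow, NNReal.coe_ofNat]
  field_simp

theorem upper_bound {X : Type*} [MetricSpace X] (hX : IsCAT0 X) {c : ℝ≥0 → X} (hc : Isometry c)
    {y : X} {b : ℝ} (h1 : Tendsto (fun s : ℝ≥0 => dist y (c s) - (s : ℝ)) atTop (𝓝 b))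
    (s : ℝ≥0) (hs : 0 < s) :
    dist y (c s) ^ 2 ≤ s ^ 2 + dist y (c 0) ^ 2 + s * (2 * b) := by
  have key := double_bound (G := fun s => dist y (c s) ^ 2 - (s : ℝ) ^ 2 - dist y (c 0) ^ 2)
    (L := 2 * b) ?_ ?_ s hs
  · linarith
  · intro s
    have := hX.cn y (c 0) (c (2 * s)) (c s)
    simp only [dist_ray hc, NNReal.coe_mul, NNReal.coe_ofNat, NNReal.coe_zero, zero_sub,
      abs_neg, abs_mul, NNReal.abs_eq, abs_two] at this
    have e : |(s : ℝ) - 2 * s| = s := by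
      rw [show (s : ℝ) - 2 * s = -s by ring, abs_neg, NNReal.abs_eq]
    have := this (by ring) (by rw [e]; ring)
    simp only [NNReal.coe_mul, NNReal.coe_ofNat]
    nlinarith
  · have hinv : Tendsto (fun s : ℝ≥0 => ((s : ℝ))⁻¹) atTop (𝓝 0) :=
      tendsto_inv_atTop_zero.comp nn_tendsto
    have := (((h1.pow 2).mul hinv).add (h1.const_mul 2)).sub (hinv.const_mul (dist y (c 0) ^ 2))
    rw [mul_zero, mul_zero, zero_add, sub_zero] at this
    refine this.congr' ?_
    filter_upwards [nn_tendsto.eventually_gt_atTop 0] with s hs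
    field_simp
    ring

theorem thales {X : Type*} [MetricSpace X] (hX : IsCAT0 X) {x y z m n : X}
    (hm1 : dist x m = dist x y / 2) (hm2 : dist m y = dist x y / 2)
    (hn1 : dist x n = dist x z / 2) (hn2 : dist n z = dist x z / 2) :
    dist m n ≤ dist y z / 2 := by
  have a := hX.cn n x y m hm1 hm2
  have b := hX.cn y x z n hn1 hn2
  rw [dist_comm n x, dist_comm n y, hn1] at a
  rw [dist_comm y x] at b
  rw [dist_comm]
  refine le_of_abs_le (abs_le_of_sq_le_sq ?_ (by positivity))
  nlinarith

theorem limit_facts {X : Type*} [MetricSpace X] (hX : IsCAT0 X)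
    (r : ℝ → X) (hr : Isometry r) (g : X ≃ᵢ X) (l : ℝ) (hl : 0 < l)
    (htrans : ∀ t : ℝ, g (r t) = r (t + l))
    (c : ℝ≥0 → X) (hc : Isometry c)
    (hfix : AsympRay (fun t => g (c t)) c) :
    ∃ q : ℝ,
      Tendsto (fun t : ℝ≥0 => dist (r (-(t : ℝ))) (c t) ^ 2 / (t : ℝ) ^ 2) atTop (𝓝 (2 - 2 * q)) ∧
      Tendsto (fun t : ℝ≥0 => dist (c t) (r t) ^ 2 / (t : ℝ) ^ 2) atTop (𝓝 (2 + 2 * q)) := by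
  choose B hB using fun x => busemann_exists hc x
  obtain ⟨C, hC⟩ := hfix
  have hB' : ∀ x, Tendsto (fun s : ℝ≥0 => dist (g x) (g (c s)) - (s : ℝ)) atTop (𝓝 (B x)) := by
    intro x; simpa only [g.isometry.dist_eq] using hB x
  have hC' : ∀ t, dist (c t) (g (c t)) ≤ C := fun t => by rw [dist_comm]; exact hC t
  have heq : ∀ x y, B (g y) - B (g x) = B y - B x := fun x y =>
    le_antisymm (busemann_cmp hX hC (hB' x) (hB' y) (hB (g x)) (hB (g y)))
      (busemann_cmp hX (c := c) (c' := fun t => g (c t)) hC'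
        (hB (g x)) (hB (g y)) (hB' x) (hB' y))
  have hlip : ∀ x y, B x - B y ≤ dist x y := by
    intro x y
    refine le_of_tendsto' ((hB x).sub (hB y)) fun s => ?_
    have := dist_triangle x y (c s)
    linarith
  set κ := B (r l) - B (r 0) with hκ
  have hstep : ∀ t, B (r (t + l)) = B (r t) + κ := by
    intro t
    have := heq (r 0) (r t)
    rw [htrans, htrans, zero_add] at this
    rw [hκ]; linarith
  obtain ⟨q, hq⟩ : ∃ q, q = κ / l := ⟨_, rfl⟩
  have hql : q * l = κ := by rw [hq]; field_simp
  have hper : Function.Periodic (fun t => B (r t) - q * t) l := by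
    intro t
    simp only [hstep]
    linarith
  obtain ⟨M, hM⟩ : ∃ M, ∀ t, |B (r t) - q * t| ≤ M := by
    refine ⟨|B (r 0)| + l + |q| * l, fun t => ?_⟩
    obtain ⟨u, hu, hut⟩ := hper.exists_mem_Ico₀ hl t
    rw [hut]
    have a1 := hlip (r u) (r 0)
    have a2 := hlip (r 0) (r u)
    rw [hr.dist_eq, Real.dist_eq] at a1 a2
    rw [sub_zero, abs_of_nonneg hu.1] at a1
    rw [zero_sub, abs_neg, abs_of_nonneg hu.1] at a2
    have a3 : |q * u| ≤ |q| * l := by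
      rw [abs_mul, abs_of_nonneg hu.1]; gcongr; exact hu.2.le
    have := abs_le.1 a3
    have := hu.2
    rw [abs_le]; constructor <;> linarith [neg_abs_le (B (r 0)), le_abs_self (B (r 0))]
  obtain ⟨D, hD⟩ : ∃ D, D = dist (r 0) (c 0) := ⟨_, rfl⟩
  have hD0 : 0 ≤ D := hD ▸ dist_nonneg
  have hM0 : 0 ≤ M := (abs_nonneg _).trans (hM 0)
  have hd : ∀ t : ℝ, dist (r t) (c 0) ≤ |t| + D := by
    intro t
    have := dist_triangle (r t) (r 0) (c 0)
    rw [hr.dist_eq, Real.dist_eq, sub_zero, ← hD] at this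
    exact this
  have up : ∀ (u : ℝ) (s : ℝ≥0), 0 < s → |u| = s →
      dist (r u) (c s) ^ 2 ≤ 2 * s ^ 2 + 2 * q * u * s + (2 * D + 2 * M) * s + D ^ 2 := by
    intro u s hs hu
    have h := upper_bound hX hc (hB (r u)) s hs
    have h2 := hd u
    rw [hu] at h2
    have h3 : dist (r u) (c 0) ^ 2 ≤ (s + D) ^ 2 := pow_le_pow_left₀ dist_nonneg h2 2
    have h4 := (abs_le.1 (hM u)).2
    have h5 : (s : ℝ) * (2 * B (r u)) ≤ s * (2 * (q * u + M)) := by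
      gcongr; linarith
    nlinarith
  have low : ∀ s : ℝ≥0, 4 * (s : ℝ) ^ 2 - 4 * D * s ≤
      dist (r (-(s : ℝ))) (c s) ^ 2 + dist (r s) (c s) ^ 2 := by
    intro s
    have h := hX.cn (c s) (r (-(s : ℝ))) (r s) (r 0)
    simp only [hr.dist_eq, Real.dist_eq] at h
    have e1 : |-(s : ℝ) - 0| = s := by simp
    have e2 : |(0 : ℝ) - s| = s := by simp
    have e3 : |-(s : ℝ) - s| = 2 * s := by
      rw [show -(s : ℝ) - s = -(2 * s) by ring, abs_neg, abs_of_nonneg (by positivity)]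
    rw [e1, e2, e3] at h
    have h := h (by ring) (by ring)
    have t := dist_triangle (c 0) (r 0) (c s)
    rw [dist_ray hc, NNReal.coe_zero, zero_sub, abs_neg, NNReal.abs_eq, dist_comm (c 0), ← hD] at t
    rw [dist_comm (c s), dist_comm (c s), dist_comm (c s)] at h
    have hx := dist_nonneg (x := r 0) (y := c s)
    have hsq : (s : ℝ) ^ 2 - 2 * D * s ≤ dist (r 0) (c s) ^ 2 := by
      by_cases hsD : (s : ℝ) ≤ D
      · nlinarith [s.2, mul_nonneg s.2 (sub_nonneg.2 hsD), mul_nonneg s.2 hD0]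
      · push Not at hsD
        nlinarith [pow_le_pow_left₀ (sub_nonneg.2 hsD.le) (by linarith : (s : ℝ) - D ≤ dist (r 0) (c s)) 2]
    nlinarith
  have hinv : Tendsto (fun s : ℝ≥0 => ((s : ℝ))⁻¹) atTop (𝓝 0) :=
    tendsto_inv_atTop_zero.comp nn_tendsto
  have hub : ∀ a K L : ℝ, Tendsto (fun s : ℝ≥0 => a + K * (s : ℝ)⁻¹ + L * (s : ℝ)⁻¹ ^ 2) atTop (𝓝 a) := by
    intro a K L
    have := ((hinv.const_mul K).const_add a).add ((hinv.pow 2).const_mul L)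
    simpa using this
  have up1 : ∀ s : ℝ≥0, 0 < s → dist (r s) (c s) ^ 2 ≤
      (2 + 2 * q) * s ^ 2 + (2 * D + 2 * M) * s + D ^ 2 := by
    intro s hs
    have := up s s hs (NNReal.abs_eq s)
    nlinarith
  have up2 : ∀ s : ℝ≥0, 0 < s → dist (r (-(s : ℝ))) (c s) ^ 2 ≤
      (2 - 2 * q) * s ^ 2 + (2 * D + 2 * M) * s + D ^ 2 := by
    intro s hs
    have := up (-s) s hs (by rw [abs_neg, NNReal.abs_eq])
    nlinarith
  have fin : ∀ (f : ℝ≥0 → ℝ) (a K L K' L' : ℝ),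
      (∀ s : ℝ≥0, 0 < s → f s ≤ a * s ^ 2 + K * s + L) →
      (∀ s : ℝ≥0, 0 < s → a * s ^ 2 + K' * s + L' ≤ f s) →
      Tendsto (fun s : ℝ≥0 => f s / (s : ℝ) ^ 2) atTop (𝓝 a) := by
    intro f a K L K' L' h1 h2
    refine tendsto_of_tendsto_of_tendsto_of_le_of_le' (hub a K' L') (hub a K L) ?_ ?_
    · filter_upwards [eventually_gt_atTop 0] with s hs
      have hs' : (0 : ℝ) < s := by exact_mod_cast hs
      rw [le_div_iff₀ (by positivity)]
      refine le_trans (le_of_eq ?_) (h2 s hs)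
      field_simp
    · filter_upwards [eventually_gt_atTop 0] with s hs
      have hs' : (0 : ℝ) < s := by exact_mod_cast hs
      rw [div_le_iff₀ (by positivity)]
      refine (h1 s hs).trans (le_of_eq ?_)
      field_simp
  refine ⟨q, fin _ _ _ _ (-(4 * D) - (2 * D + 2 * M)) (-D ^ 2) up2 ?_, ?_⟩
  · intro s hs
    have := low s
    have := up1 s hs
    nlinarith
  · simp only [dist_comm (c _)]
    refine fin _ _ _ _ (-(4 * D) - (2 * D + 2 * M)) (-D ^ 2) up1 ?_
    intro s hs
    have := low s
    have := up2 s hs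
    nlinarith

theorem sqrt_lim {f : ℝ≥0 → ℝ} {a : ℝ} (hf : ∀ s, 0 ≤ f s)
    (h : Tendsto (fun s : ℝ≥0 => f s ^ 2 / (s : ℝ) ^ 2) atTop (𝓝 a)) :
    Tendsto (fun s : ℝ≥0 => f s / (s : ℝ)) atTop (𝓝 (√a)) := by
  refine h.sqrt.congr fun s => ?_
  rw [← div_pow, Real.sqrt_sq (div_nonneg (hf s) s.coe_nonneg)]

/-- If an isometry `g` of a complete CAT(0) space translates a geodesic `r`
nontrivially and fixes a boundary point `ξ` (represented by a ray `c`), then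
`∠_Tits(ξ⁻, ξ) + ∠_Tits(ξ, ξ⁺) = π`; in particular if `ξ` is opposite to `ξ⁻`
(joined to it by a geodesic line) then `ξ = ξ⁺`. -/
theorem stmt3 {X : Type*} [MetricSpace X] [CompleteSpace X] (hX : IsCAT0 X)
    (r : ℝ → X) (hr : Isometry r) (g : X ≃ᵢ X) (l : ℝ) (hl : 0 < l)
    (htrans : ∀ t : ℝ, g (r t) = r (t + l))
    (c : ℝ≥0 → X) (hc : Isometry c)
    (hfix : AsympRay (fun t => g (c t)) c) :
    titsAngle (fun t : ℝ≥0 => r (-(t : ℝ))) c + titsAngle c (fun t : ℝ≥0 => r (t : ℝ))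
      = Real.pi ∧
    ((∃ ρ : ℝ → X, Isometry ρ ∧
        AsympRay (fun t : ℝ≥0 => ρ (-(t : ℝ))) (fun t : ℝ≥0 => r (-(t : ℝ))) ∧
        AsympRay (fun t : ℝ≥0 => ρ (t : ℝ)) c) →
      AsympRay c (fun t : ℝ≥0 => r (t : ℝ))) := by
  obtain ⟨q, h1, h2⟩ := limit_facts hX r hr g l hl htrans c hc hfix
  have l1 := sqrt_lim (f := fun t : ℝ≥0 => dist (r (-(t : ℝ))) (c t)) (fun _ => dist_nonneg) h1
  have l2 := sqrt_lim (f := fun t : ℝ≥0 => dist (c t) (r t)) (fun _ => dist_nonneg) h2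
  have q1 : 0 ≤ 2 - 2 * q := ge_of_tendsto' h1 fun s => by positivity
  have q2 : 0 ≤ 2 + 2 * q := ge_of_tendsto' h2 fun s => by positivity
  refine ⟨?_, ?_⟩
  · unfold titsAngle
    rw [l1.limsup_eq, l2.limsup_eq]
    have e : √(2 - 2 * q) / 2 = √(1 - (√(2 + 2 * q) / 2) ^ 2) := by
      rw [div_pow, Real.sq_sqrt q2, eq_comm, Real.sqrt_eq_iff_mul_self_eq (by linarith)
        (by positivity), div_mul_div_comm, Real.mul_self_sqrt q1]
      ring
    rw [e, ← Real.arccos_eq_arcsin (by positivity), Real.arccos_eq_pi_div_two_sub_arcsin]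
    ring
  · rintro ⟨ρ, hρ, ⟨C1, hC1⟩, ⟨C2, hC2⟩⟩
    have hinv : Tendsto (fun s : ℝ≥0 => ((s : ℝ))⁻¹) atTop (𝓝 0) :=
      tendsto_inv_atTop_zero.comp nn_tendsto
    have hq : 2 ≤ √(2 - 2 * q) := by
      have h3 : Tendsto (fun s : ℝ≥0 => 2 - (C1 + C2) * ((s : ℝ))⁻¹) atTop (𝓝 2) := by
        simpa using (hinv.const_mul (C1 + C2)).const_sub 2
      refine le_of_tendsto_of_tendsto h3 l1 ?_
      filter_upwards [nn_tendsto.eventually_gt_atTop 0] with s hs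
      have a := dist_triangle4 (ρ (-(s : ℝ))) (r (-(s : ℝ))) (c s) (ρ s)
      have e3 : dist (ρ (-(s : ℝ))) (ρ s) = 2 * s := by
        rw [hρ.dist_eq, Real.dist_eq, show -(s : ℝ) - s = -(2 * s) by ring, abs_neg,
          abs_of_nonneg (by positivity)]
      have b1 := hC1 s
      have b2 := hC2 s
      rw [dist_comm] at b2
      simp only at b1 b2
      rw [le_div_iff₀ hs, sub_mul, mul_assoc, inv_mul_cancel₀ hs.ne']
      linarith
    have hq0 : 2 + 2 * q = 0 := by
      have := Real.sq_sqrt q1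
      nlinarith
    rw [hq0, Real.sqrt_zero] at l2
    have l3 : Tendsto (fun s : ℝ≥0 => (dist (ρ s) (r s) - dist (ρ 0) (r 0)) / (s : ℝ))
        atTop (𝓝 0) := by
      have l4 : Tendsto (fun s : ℝ≥0 => dist (ρ s) (r s) / (s : ℝ)) atTop (𝓝 0) := by
        have h5 := l2.add (hinv.const_mul C2)
        rw [mul_zero, add_zero] at h5
        refine squeeze_zero (fun s => by positivity) (fun s => ?_) h5
        have b2 := hC2 s
        simp only at b2
        rw [← div_eq_mul_inv, ← add_div]
        gcongr
        linarith [dist_triangle (ρ s) (c s) (r s)]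
      have := l4.sub (hinv.const_mul (dist (ρ 0) (r 0)))
      rw [mul_zero, sub_zero] at this
      refine this.congr fun s => by rw [← div_eq_mul_inv, ← sub_div]
    have mid : ∀ (f : ℝ → X), Isometry f → ∀ s : ℝ≥0,
        dist (f 0) (f s) = dist (f 0) (f (2 * s)) / 2 ∧
        dist (f s) (f (2 * s)) = dist (f 0) (f (2 * s)) / 2 := by
      intro f hf s
      simp only [hf.dist_eq, Real.dist_eq]
      rw [zero_sub, zero_sub, abs_neg, abs_neg, abs_mul, abs_two, NNReal.abs_eq,
        show (s : ℝ) - 2 * s = -s by ring, abs_neg, NNReal.abs_eq]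
      constructor <;> ring
    have hbd : ∀ s : ℝ≥0, 0 < s → dist (ρ s) (r s) - dist (ρ 0) (r 0) ≤ s * 0 := by
      refine double_bound (G := fun s : ℝ≥0 => dist (ρ s) (r s) - dist (ρ 0) (r 0)) ?_ l3
      intro s
      obtain ⟨n, n1, n2⟩ := hX.midpoint (ρ 0) (r (2 * s))
      obtain ⟨m1, m2⟩ := mid ρ hρ s
      obtain ⟨m3, m4⟩ := mid r hr s
      have t1 := thales hX m1 m2 n1 n2
      have t2 := thales hX (x := r (2 * s)) (y := r 0) (z := ρ 0) (m := r s) (n := n)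
        (by rw [dist_comm, m4, dist_comm (r 0)]) (by rw [dist_comm, m3, dist_comm (r 0)])
        (by rw [dist_comm, n2, dist_comm (ρ 0)]) (by rw [dist_comm, n1, dist_comm (ρ 0)])
      have t3 := dist_triangle_right (ρ s) (r s) n
      rw [dist_comm (r 0)] at t2
      simp only [NNReal.coe_mul, NNReal.coe_ofNat]
      linarith
    refine ⟨C2 + dist (ρ 0) (r 0), fun s => ?_⟩
    have b2 := hC2 s
    simp only at b2 ⊢
    have t := dist_triangle_left (c s) (r s) (ρ s)
    rcases eq_or_lt_of_le (show 0 ≤ s from zero_le) with h | h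
    · subst h
      simp only [NNReal.coe_zero] at *
      linarith
    · have := hbd s h
      linarith
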